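/- In Setup (§1): the map (A,B) ↦ (A^−, B^−) is a bijection from the set T₁ onto the set 𝔗₁ := { ({a^X_i : i ∈ [0,N] even}, {a^X_i : i ∈ [0,N] odd}) : X ⊆ {1,3,…,2M−1} } of ordered pairs of subsets of ℕ. -/

import Mathlib

/-- `p` arises from `a` by exchanging the values at `2k+1` and `2k+2` for some of the `k < n`. -/
def IsPairSwap (n : ℕ) (a p : ℕ → ℕ) : Prop :=
  p 0 = a 0 ∧ ∀ k < n, (p (2 * k + 1) = a (2 * k + 1) ∧ p (2 * k + 2) = a (2 * k + 2)) ∨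
    (p (2 * k + 1) = a (2 * k + 2) ∧ p (2 * k + 2) = a (2 * k + 1))

theorem le_of_forall_le_succ {N : ℕ} {a : ℕ → ℕ} (hmono : ∀ i, i + 1 ≤ N → a i ≤ a (i + 1))
    {i j : ℕ} (hij : i ≤ j) (hj : j ≤ N) : a i ≤ a j := by
  induction j, hij using Nat.le_induction with
  | base => exact le_rfl
  | succ j _ ih => exact (ih (by omega)).trans (hmono j hj)

theorem lt_of_forall_lt_add_two {n c : ℕ} {p : ℕ → ℕ}
    (hp : ∀ i, i + 2 ≤ 2 * n → p i < p (i + 2)) {i j : ℕ} (hij : i < j) (hj : 2 * j + c ≤ 2 * n) :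
    p (2 * i + c) < p (2 * j + c) := by
  induction j, hij using Nat.le_induction with
  | base => exact (hp (2 * i + c) (by omega)).trans_eq (congrArg p (by omega))
  | succ j _ ih =>
    exact (ih (by omega)).trans ((hp (2 * j + c) (by omega)).trans_eq (congrArg p (by omega)))

/-! ### Multisets indexed by an initial segment -/

theorem map_range_two_mul_add_one {α : Type*} (n : ℕ) (f : ℕ → α) :
    (Multiset.range (2 * n + 1)).map f =
      (Multiset.range (n + 1)).map (fun k => f (2 * k)) +
        (Multiset.range n).map (fun k => f (2 * k + 1)) := by
  induction n with
  | zero => simp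
  | succ n ih =>
    rw [show 2 * (n + 1) + 1 = 2 * n + 1 + 1 + 1 by ring, Multiset.range_succ (2 * n + 1 + 1),
      Multiset.range_succ (2 * n + 1), Multiset.range_succ (n + 1), Multiset.range_succ n]
    simp only [Multiset.map_cons, ih]
    rw [Multiset.range_succ]
    simp only [Multiset.map_cons, Multiset.cons_add, Multiset.add_cons]
    exact Multiset.cons_swap ..

theorem IsPairSwap.map_range_eq {n : ℕ} {a p : ℕ → ℕ} (h : IsPairSwap n a p) (f : ℕ → ℕ → ℕ)
    (hf : ∀ k, f (2 * k + 2) = f (2 * k + 1)) :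
    (Multiset.range (2 * n + 1)).map (fun i => f i (p i)) =
      (Multiset.range (2 * n + 1)).map fun i => f i (a i) := by
  induction n with
  | zero => simp [h.1]
  | succ n ih =>
    rw [show 2 * (n + 1) + 1 = 2 * n + 1 + 1 + 1 by ring, Multiset.range_succ (2 * n + 1 + 1),
      Multiset.range_succ (2 * n + 1)]
    simp only [Multiset.map_cons, ih ⟨h.1, fun k hk => h.2 k (by omega)⟩]
    rcases h.2 n (by omega) with ⟨h1, h2⟩ | ⟨h1, h2⟩
    · rw [h1, h2]
    · rw [h1, h2, hf n, Multiset.cons_swap]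

theorem map_Ico_eq_cons {α : Type*} (f : ℕ → α) {s t : ℕ} (h : s < t) :
    (Finset.Ico s t).val.map f = f s ::ₘ (Finset.Ico (s + 1) t).val.map f := by
  rw [← Finset.insert_Ico_add_one_left_eq_Ico h, Finset.insert_val_of_notMem (by simp),
    Multiset.map_cons]

/-- The multisets of values `p i` and of shifted values `p i + ⌈i/2⌉` together determine `p` up to
exchanges within the pairs `{2k+1, 2k+2}`. -/
theorem isPairSwap_of_map_range_eq {n : ℕ} {a p : ℕ → ℕ}
    (hmono : ∀ i, i + 1 ≤ 2 * n → a i ≤ a (i + 1))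
    (h : (Multiset.range (2 * n + 1)).map p = (Multiset.range (2 * n + 1)).map a)
    (hshift : (Multiset.range (2 * n + 1)).map (fun i => p i + (i + 1) / 2) =
      (Multiset.range (2 * n + 1)).map fun i => a i + (i + 1) / 2) :
    IsPairSwap n a p := by
  have hrange : Multiset.range (2 * n + 1) = (Finset.Ico 0 (2 * n + 1)).val := by
    rw [← Finset.range_eq_Ico]; rfl
  rw [hrange, map_Ico_eq_cons _ (by omega), map_Ico_eq_cons (fun i => a i + (i + 1) / 2) (by omega)]
    at hshift
  rw [hrange, map_Ico_eq_cons _ (by omega), map_Ico_eq_cons a (by omega)] at h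
  have hle : ∀ {s : ℕ} {x : ℕ}, x ∈ a s ::ₘ (Finset.Ico (s + 1) (2 * n + 1)).val.map a →
      a s ≤ x := by
    intro s x hx
    rcases Multiset.mem_cons.1 hx with rfl | hx
    · exact le_rfl
    · obtain ⟨i, hi, rfl⟩ := Multiset.mem_map.1 hx
      rw [Finset.mem_val, Finset.mem_Ico] at hi
      exact le_of_forall_le_succ hmono (by omega) (by omega)
  have hzero : p 0 = a 0 := by
    have hmem : a 0 + (0 + 1) / 2 ∈ (p 0 + (0 + 1) / 2) ::ₘ
        (Finset.Ico (0 + 1) (2 * n + 1)).val.map (fun i => p i + (i + 1) / 2) := by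
      rw [hshift]; exact Multiset.mem_cons_self _ _
    rcases Multiset.mem_cons.1 hmem with h0 | h0
    · omega
    · obtain ⟨i, hi, hpi⟩ := Multiset.mem_map.1 h0
      have := hle (s := 0) (h ▸ Multiset.mem_cons_of_mem (Multiset.mem_map_of_mem p hi))
      rw [Finset.mem_val, Finset.mem_Ico] at hi
      omega
  rw [hzero, Multiset.cons_inj_right] at h hshift
  suffices H : ∀ m ≤ n, IsPairSwap m a p ∧
      (Finset.Ico (2 * m + 1) (2 * n + 1)).val.map p =
        (Finset.Ico (2 * m + 1) (2 * n + 1)).val.map a ∧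
      (Finset.Ico (2 * m + 1) (2 * n + 1)).val.map (fun i => p i + (i + 1) / 2) =
        (Finset.Ico (2 * m + 1) (2 * n + 1)).val.map fun i => a i + (i + 1) / 2 from
    (H n le_rfl).1
  intro m hm
  induction m with
  | zero => exact ⟨⟨hzero, fun k hk => absurd hk (by omega)⟩, h, hshift⟩
  | succ m ih =>
    obtain ⟨hps, h, hshift⟩ := ih (by omega)
    have hc : (2 * m + 1 + 1 + 1) / 2 = (2 * m + 1 + 1) / 2 := by omega
    rw [map_Ico_eq_cons _ (show 2 * m + 1 < 2 * n + 1 by omega),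
      map_Ico_eq_cons _ (show 2 * m + 1 + 1 < 2 * n + 1 by omega),
      map_Ico_eq_cons a (show 2 * m + 1 < 2 * n + 1 by omega),
      map_Ico_eq_cons a (show 2 * m + 1 + 1 < 2 * n + 1 by omega)] at h
    rw [map_Ico_eq_cons _ (show 2 * m + 1 < 2 * n + 1 by omega),
      map_Ico_eq_cons _ (show 2 * m + 1 + 1 < 2 * n + 1 by omega),
      map_Ico_eq_cons _ (show 2 * m + 1 < 2 * n + 1 by omega),
      map_Ico_eq_cons _ (show 2 * m + 1 + 1 < 2 * n + 1 by omega), hc] at hshift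
    -- the second value of the pair is determined once the first one has been removed
    have hsnd : ∀ u,
        u ::ₘ (Finset.Ico (2 * m + 1 + 1 + 1) (2 * n + 1)).val.map p =
          a (2 * m + 1 + 1) ::ₘ (Finset.Ico (2 * m + 1 + 1 + 1) (2 * n + 1)).val.map a →
        (u + (2 * m + 1 + 1) / 2) ::ₘ
            (Finset.Ico (2 * m + 1 + 1 + 1) (2 * n + 1)).val.map (fun i => p i + (i + 1) / 2) =
          (a (2 * m + 1 + 1) + (2 * m + 1 + 1) / 2) ::ₘ
            (Finset.Ico (2 * m + 1 + 1 + 1) (2 * n + 1)).val.map (fun i => a i + (i + 1) / 2) →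
        u = a (2 * m + 1 + 1) := by
      intro u hu hu'
      have hmem := hu'.symm ▸ Multiset.mem_cons_self (a (2 * m + 1 + 1) + (2 * m + 1 + 1) / 2) _
      rcases Multiset.mem_cons.1 hmem with h0 | h0
      · omega
      · obtain ⟨i, hi, hpi⟩ := Multiset.mem_map.1 h0
        have := hle (hu ▸ Multiset.mem_cons_of_mem (Multiset.mem_map_of_mem p hi))
        rw [Finset.mem_val, Finset.mem_Ico] at hi
        omega
    have hfst : p (2 * m + 1) = a (2 * m + 1) ∨ p (2 * m + 1 + 1) = a (2 * m + 1) := by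
      have hmem := hshift.symm ▸ Multiset.mem_cons_self (a (2 * m + 1) + (2 * m + 1 + 1) / 2) _
      rcases Multiset.mem_cons.1 hmem with h0 | h0
      · omega
      rcases Multiset.mem_cons.1 h0 with h0 | h0
      · omega
      · obtain ⟨i, hi, hpi⟩ := Multiset.mem_map.1 h0
        have hmem := Multiset.mem_cons_of_mem (b := p (2 * m + 1))
          (Multiset.mem_cons_of_mem (b := p (2 * m + 1 + 1)) (Multiset.mem_map_of_mem p hi))
        rw [h, ← map_Ico_eq_cons a (show 2 * m + 1 + 1 < 2 * n + 1 by omega)] at hmem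
        have := hle hmem
        rw [Finset.mem_val, Finset.mem_Ico] at hi
        omega
    have key : ((p (2 * m + 1) = a (2 * m + 1) ∧ p (2 * m + 2) = a (2 * m + 2)) ∨
        (p (2 * m + 1) = a (2 * m + 2) ∧ p (2 * m + 2) = a (2 * m + 1))) ∧
        (Finset.Ico (2 * m + 1 + 1 + 1) (2 * n + 1)).val.map p =
          (Finset.Ico (2 * m + 1 + 1 + 1) (2 * n + 1)).val.map a ∧
        (Finset.Ico (2 * m + 1 + 1 + 1) (2 * n + 1)).val.map (fun i => p i + (i + 1) / 2) =
          (Finset.Ico (2 * m + 1 + 1 + 1) (2 * n + 1)).val.map fun i => a i + (i + 1) / 2 := by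
      rcases hfst with h0 | h0
      · rw [h0, Multiset.cons_inj_right] at h hshift
        have h1 := hsnd _ h hshift
        rw [h1, Multiset.cons_inj_right] at h hshift
        exact ⟨.inl ⟨h0, h1⟩, h, hshift⟩
      · rw [Multiset.cons_swap, h0, Multiset.cons_inj_right] at h hshift
        have h1 := hsnd _ h hshift
        rw [h1, Multiset.cons_inj_right] at h hshift
        exact ⟨.inr ⟨h1, h0⟩, h, hshift⟩
    refine ⟨⟨hzero, fun k hk => ?_⟩, key.2⟩
    rcases Nat.lt_succ_iff_lt_or_eq.1 hk with hk | rfl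
    · exact hps.2 k hk
    · exact key.1

/-! ### Sorted enumerations of finite sets -/

theorem sort_image_range {n : ℕ} {x : ℕ → ℕ} (hx : ∀ i j, i < j → j < n → x i < x j) :
    ((Finset.range n).image x).sort (· ≤ ·) = (List.range n).map x := by
  have hpw : ((List.range n).map x).Pairwise (· < ·) := by
    rw [List.pairwise_map]
    exact (List.pairwise_lt_range (n := n)).imp_of_mem fun {i j} _ hj hij =>
      hx i j hij (List.mem_range.1 hj)
  have : (Finset.range n).image x = ((List.range n).map x).toFinset := by
    ext; simp
  rw [this]
  exact (List.toFinset_sort (· ≤ ·) (hpw.imp fun h => h.ne)).2 (hpw.imp fun h => h.le)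

theorem exists_strictMono_image_range (A : Finset ℕ) :
    ∃ x : ℕ → ℕ, (∀ i j, i < j → j < A.card → x i < x j) ∧
      A = (Finset.range A.card).image x := by
  refine ⟨fun i => if h : i < A.card then A.orderEmbOfFin rfl ⟨i, h⟩ else 0, ?_, ?_⟩
  · intro i j hij hj
    simp only [hj, hij.trans hj, dif_pos]
    exact (A.orderEmbOfFin rfl).strictMono hij
  · ext y
    have hr := congrArg (y ∈ ·) (A.range_orderEmbOfFin rfl)
    simp only [Set.mem_range, Finset.mem_coe, eq_iff_iff] at hr
    rw [← hr, Finset.mem_image]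
    constructor
    · rintro ⟨i, rfl⟩
      exact ⟨i, by simp, by simp⟩
    · rintro ⟨i, hi, rfl⟩
      exact ⟨⟨i, Finset.mem_range.1 hi⟩, by simp [Finset.mem_range.1 hi]⟩

theorem mapIdx_map_range {α β : Type*} (n : ℕ) (x : ℕ → α) (f : ℕ → α → β) :
    ((List.range n).map x).mapIdx f = (List.range n).map fun k => f k (x k) := by
  apply List.ext_getElem <;> simp

theorem eq_of_image_range_eq {n : ℕ} {x y : ℕ → ℕ} (hx : ∀ i j, i < j → j < n → x i < x j)
    (hy : ∀ i j, i < j → j < n → y i < y j)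
    (h : (Finset.range n).image x = (Finset.range n).image y) {k : ℕ} (hk : k < n) :
    x k = y k := by
  have := sort_image_range hx
  rw [h, sort_image_range hy] at this
  exact (List.map_inj_left.1 this k (List.mem_range.2 hk)).symm

theorem image_filter_mod_two {n : ℕ} (p : ℕ → ℕ) :
    ((Finset.range (2 * n + 1)).filter fun i => i % 2 = 0).image p =
        (Finset.range (n + 1)).image (fun k => p (2 * k)) ∧
      ((Finset.range (2 * n + 1)).filter fun i => i % 2 = 1).image p =
        (Finset.range n).image fun k => p (2 * k + 1) := by
  constructor <;> ext y <;> simp only [Finset.mem_image, Finset.mem_filter, Finset.mem_range]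
  · constructor
    · rintro ⟨i, hi, rfl⟩
      exact ⟨i / 2, by omega, congrArg p (by omega)⟩
    · rintro ⟨k, hk, rfl⟩
      exact ⟨2 * k, by omega, rfl⟩
  · constructor
    · rintro ⟨i, hi, rfl⟩
      exact ⟨i / 2, by omega, congrArg p (by omega)⟩
    · rintro ⟨k, hk, rfl⟩
      exact ⟨2 * k + 1, by omega, rfl⟩

/-! ### The values occurring once -/

section Unpaired

variable {N M : ℕ} {a I : ℕ → ℕ}

theorem exists_enum_eq_iff (hmono : ∀ i, i + 1 ≤ N → a i ≤ a (i + 1))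
    (hIJ : ∀ i, (i ≤ N ∧ ((Finset.range (N + 1)).filter fun j => a j = a i).card = 1)
      ↔ ∃ s, s ≤ 2 * M ∧ I s = i) {i : ℕ} (hi : i ≤ N) :
    (∃ s, s ≤ 2 * M ∧ I s = i) ↔ (0 < i → a (i - 1) ≠ a i) ∧ (i + 1 ≤ N → a i ≠ a (i + 1)) := by
  rw [← hIJ i, Finset.card_eq_one]
  constructor
  · rintro ⟨-, b, hb⟩
    have key : ∀ j ≤ N, a j = a i → j = i := by
      intro j hj hji
      have h1 : j ∈ ({b} : Finset ℕ) := by rw [← hb]; simp [hji]; omega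
      have h2 : i ∈ ({b} : Finset ℕ) := by rw [← hb]; simp; omega
      rw [Finset.mem_singleton] at h1 h2
      omega
    exact ⟨fun h0 h => by have := key (i - 1) (by omega) h; omega,
      fun h0 h => by have := key (i + 1) h0 h.symm; omega⟩
  · rintro ⟨hl, hr⟩
    refine ⟨hi, i, ?_⟩
    ext j
    simp only [Finset.mem_filter, Finset.mem_range, Finset.mem_singleton]
    refine ⟨fun ⟨hj, hji⟩ => ?_, fun h => by subst h; exact ⟨by omega, rfl⟩⟩
    rcases lt_trichotomy j i with h | h | h
    · have h1 := le_of_forall_le_succ hmono (show j ≤ i - 1 by omega) (by omega)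
      have h2 := hmono (i - 1) (by omega)
      rw [show i - 1 + 1 = i by omega] at h2
      have := hl (by omega)
      omega
    · exact h
    · have h1 := le_of_forall_le_succ hmono (show i + 1 ≤ j by omega) (by omega)
      have h2 := hmono i (by omega)
      have := hr (by omega)
      omega

/-- With `t` the number of values `I s` below `i`, the entries at `i - 1` and `i` agree if and only
if `i` and `t` have different parities. -/
theorem exists_count_lt (hmono : ∀ i, i + 1 ≤ N → a i ≤ a (i + 1))
    (hstrict : ∀ i, i + 2 ≤ N → a i < a (i + 2))
    (hImono : ∀ s t, s < t → t ≤ 2 * M → I s < I t)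
    (hIJ : ∀ i, (i ≤ N ∧ ((Finset.range (N + 1)).filter fun j => a j = a i).card = 1)
      ↔ ∃ s, s ≤ 2 * M ∧ I s = i) {i : ℕ} (hi : i ≤ N) :
    ∃ t ≤ 2 * M + 1, (∀ s < t, I s < i) ∧ (∀ s, t ≤ s → s ≤ 2 * M → i ≤ I s) ∧
      (i % 2 ≠ t % 2 → 0 < i) ∧ (0 < i → (a (i - 1) = a i ↔ i % 2 ≠ t % 2)) := by
  induction i with
  | zero =>
    exact ⟨0, by omega, by simp, by simp, by simp, by simp⟩
  | succ i ih =>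
    obtain ⟨t, ht, hlt, hge, hpos, hpar⟩ := ih (by omega)
    have hiff := exists_enum_eq_iff hmono hIJ (show i ≤ N by omega)
    have hne : 0 < i → a (i - 1) = a i → a i ≠ a (i + 1) := by
      intro h0 h1 h2
      have := hstrict (i - 1) (by omega)
      rw [show i - 1 + 2 = i + 1 by omega] at this
      omega
    by_cases hs : ∃ s, s ≤ 2 * M ∧ I s = i
    · obtain ⟨h1, h2⟩ := hiff.1 hs
      obtain ⟨s, hsM, hsi⟩ := hs
      have hst : t = s := by
        rcases lt_trichotomy s t with h | h | h
        · have := hlt s h; omega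
        · exact h.symm
        · have := hge t le_rfl (by omega)
          have := hImono t s h hsM
          omega
      subst hst
      refine ⟨t + 1, by omega, fun r hr => ?_, fun r hr hrM => ?_, fun _ => by omega, fun _ => ?_⟩
      · rcases Nat.lt_succ_iff_lt_or_eq.1 hr with h | rfl
        · have := hlt r h; omega
        · omega
      · have := hImono t r (by omega) hrM; omega
      · have h2 := h2 hi
        simp only [Nat.add_sub_cancel, h2, false_iff, not_not]
        have : i % 2 = t % 2 := by
          by_contra h
          exact h1 (hpos h) ((hpar (hpos h)).2 h)
        omega
    · refine ⟨t, ht, fun r hr => (hlt r hr).trans (by omega), fun r hr hrM => ?_, fun _ => by omega,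
        fun _ => ?_⟩
      · have := hge r hr hrM
        have : I r ≠ i := fun h => hs ⟨r, hrM, h⟩
        omega
      · rw [hiff] at hs
        rw [Nat.add_sub_cancel]
        by_cases h : i % 2 ≠ t % 2
        · have := hne (hpos h) ((hpar (hpos h)).2 h)
          exact ⟨fun h' => absurd h' this, fun h' => by omega⟩
        · have : a i = a (i + 1) := by
            by_contra h'
            exact hs ⟨fun h0 h1 => h ((hpar h0).1 h1), fun _ => h'⟩
          exact ⟨fun _ => by omega, fun _ => this⟩

theorem enum_mod_two (hmono : ∀ i, i + 1 ≤ N → a i ≤ a (i + 1))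
    (hstrict : ∀ i, i + 2 ≤ N → a i < a (i + 2))
    (hImono : ∀ s t, s < t → t ≤ 2 * M → I s < I t)
    (hIJ : ∀ i, (i ≤ N ∧ ((Finset.range (N + 1)).filter fun j => a j = a i).card = 1)
      ↔ ∃ s, s ≤ 2 * M ∧ I s = i) {s : ℕ} (hs : s ≤ 2 * M) : I s % 2 = s % 2 := by
  have hi : I s ≤ N := ((hIJ (I s)).2 ⟨s, hs, rfl⟩).1
  obtain ⟨t, -, hlt, hge, hpos, hpar⟩ := exists_count_lt hmono hstrict hImono hIJ hi
  have h1 := ((exists_enum_eq_iff hmono hIJ hi).1 ⟨s, hs, rfl⟩).1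
  have hst : t = s := by
    rcases lt_trichotomy s t with h | h | h
    · have := hlt s h; omega
    · exact h.symm
    · have := hge t le_rfl (by omega)
      have := hImono t s h hs
      omega
  subst hst
  by_contra h
  exact h1 (hpos h) ((hpar (hpos h)).2 h)

/-- An index `i` lies below the first unpaired index or in an interval `(I s, I (s + 1)]` with `s`
odd if and only if the parity of `i` tells whether `a (i - 1) = a i`, this being so for odd `i`. -/
theorem le_or_exists_mem_Ioc_iff (hmono : ∀ i, i + 1 ≤ N → a i ≤ a (i + 1))
    (hstrict : ∀ i, i + 2 ≤ N → a i < a (i + 2))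
    (hImono : ∀ s t, s < t → t ≤ 2 * M → I s < I t)
    (hIJ : ∀ i, (i ≤ N ∧ ((Finset.range (N + 1)).filter fun j => a j = a i).card = 1)
      ↔ ∃ s, s ≤ 2 * M ∧ I s = i) {i : ℕ} (hi0 : 0 < i) (hi : i ≤ N) :
    (i ≤ I 0 ∨ ∃ s < 2 * M, s % 2 = 1 ∧ I s < i ∧ i ≤ I (s + 1)) ↔
      (a (i - 1) = a i ↔ i % 2 = 1) := by
  obtain ⟨t, ht, hlt, hge, -, hpar⟩ := exists_count_lt hmono hstrict hImono hIJ hi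
  rw [hpar hi0]
  trans t % 2 = 0
  · constructor
    · rintro (h | ⟨s, hs, hs2, h1, h2⟩)
      · rcases Nat.eq_zero_or_pos t with h0 | h0
        · omega
        · have := hlt 0 h0; omega
      · have : t = s + 1 := by
          rcases lt_trichotomy t (s + 1) with h | h | h
          · have := hge s (by omega) (by omega); omega
          · exact h
          · have := hlt (s + 1) h; omega
        omega
    · intro h
      rcases Nat.eq_zero_or_pos t with h0 | h0
      · exact .inl (hge 0 (by omega) (by omega))
      · refine .inr ⟨t - 1, by omega, by omega, hlt _ (by omega), ?_⟩
        rw [Nat.sub_add_cancel h0]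
        exact hge t le_rfl (by omega)
  · omega

end Unpaired

/-! ### Exchanging values in blocks -/

section Blocks

variable {n M : ℕ} {a I m p : ℕ → ℕ}

theorem isPairSwap_of_blocks (hmono : ∀ i, i + 1 ≤ 2 * n → a i ≤ a (i + 1))
    (hstrict : ∀ i, i + 2 ≤ 2 * n → a i < a (i + 2))
    (hImono : ∀ s t, s < t → t ≤ 2 * M → I s < I t)
    (hIJ : ∀ i, (i ≤ 2 * n ∧ ((Finset.range (2 * n + 1)).filter fun j => a j = a i).card = 1)
      ↔ ∃ s, s ≤ 2 * M ∧ I s = i)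
    (hm : ∀ s, s < 2 * M → I (s + 1) = I s + 2 * m s + 1)
    {X : Finset ℕ} (hX : ∀ s ∈ X, s % 2 = 1 ∧ s < 2 * M)
    (hp : ∀ s ∈ X, ∀ k ≤ m s, p (I s + 2 * k) = a (I s + 2 * k + 1)
      ∧ p (I s + 2 * k + 1) = a (I s + 2 * k))
    (hp' : ∀ i ≤ 2 * n, (∀ s ∈ X, ¬ (I s ≤ i ∧ i ≤ I s + 2 * m s + 1)) → p i = a i) :
    IsPairSwap n a p ∧ ∀ i, i + 2 ≤ 2 * n → p i < p (i + 2) := by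
  have hodd : ∀ s ∈ X, I s % 2 = 1 := fun s hs => by
    rw [enum_mod_two hmono hstrict hImono hIJ (hX s hs).2.le, (hX s hs).1]
  have hpos : ∀ s ∈ X, I 0 < I s := fun s hs => by
    have := hX s hs
    exact hImono 0 s (by omega) (by omega)
  have hIle : ∀ s t, s ≤ t → t ≤ 2 * M → I s ≤ I t := fun s t hst ht => by
    rcases hst.eq_or_lt with rfl | h
    · exact le_rfl
    · exact (hImono s t h ht).le
  have hswap : ∀ k < n, (∃ s ∈ X, I s ≤ 2 * k + 1 ∧ 2 * k + 2 ≤ I (s + 1)) →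
      p (2 * k + 1) = a (2 * k + 2) ∧ p (2 * k + 2) = a (2 * k + 1) := by
    rintro k hk ⟨s, hs, h1, h2⟩
    have h3 := hodd s hs
    rw [hm s (hX s hs).2] at h2
    have := hp s hs (k - I s / 2) (by omega)
    rwa [show I s + 2 * (k - I s / 2) = 2 * k + 1 by omega] at this
  have hfix : ∀ k < n, (¬ ∃ s ∈ X, I s ≤ 2 * k + 1 ∧ 2 * k + 2 ≤ I (s + 1)) →
      p (2 * k + 1) = a (2 * k + 1) ∧ p (2 * k + 2) = a (2 * k + 2) := by
    intro k hk h
    constructor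
    · refine hp' _ (by omega) fun s hs hs' => h ⟨s, hs, ?_⟩
      have := hodd s hs
      have := hm s (hX s hs).2
      omega
    · refine hp' _ (by omega) fun s hs hs' => h ⟨s, hs, ?_⟩
      have := hodd s hs
      have := hm s (hX s hs).2
      omega
  have hzero : p 0 = a 0 := hp' 0 (by omega) fun s hs hs' => by
    have := hodd s hs
    omega
  refine ⟨⟨hzero, fun k hk => ?_⟩, fun i hi => ?_⟩
  · by_cases h : ∃ s ∈ X, I s ≤ 2 * k + 1 ∧ 2 * k + 2 ≤ I (s + 1)
    · exact .inr (hswap k hk h)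
    · exact .inl (hfix k hk h)
  have hG := fun {i : ℕ} => le_or_exists_mem_Ioc_iff hmono hstrict hImono hIJ (i := i)
  have hI0 := enum_mod_two hmono hstrict hImono hIJ (s := 0) (by omega)
  rcases Nat.eq_zero_or_pos i with rfl | hi0
  · have h1 := hmono 0 (by omega)
    have h2 := hmono 1 (by omega)
    have h3 := hstrict 0 (by omega)
    simp only [Nat.zero_add, Nat.reduceAdd] at h1 h2 h3 ⊢
    rw [hzero]
    by_cases h : a 0 = a 1
    · have hle : 1 ≤ I 0 := by
        rcases (hG (i := 1) (by omega) (by omega)).2 (by simp [h]) with h' | ⟨s, hs, hs2, hs', -⟩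
        · exact h'
        · have := hImono 0 s (by omega) hs.le
          omega
      have := (hfix 0 (by omega) fun ⟨s, hs, hs', _⟩ => by have := hpos s hs; omega).2
      simp only [Nat.mul_zero, Nat.zero_add] at this
      rw [this]
      exact h3
    · by_cases h' : ∃ s ∈ X, I s ≤ 2 * 0 + 1 ∧ 2 * 0 + 2 ≤ I (s + 1)
      · have := (hswap 0 (by omega) h').2
        simp only [Nat.mul_zero, Nat.zero_add] at this
        omega
      · have := (hfix 0 (by omega) h').2
        simp only [Nat.mul_zero, Nat.zero_add] at this
        omega
  obtain ⟨k, hk⟩ : ∃ k, i = 2 * k + 1 ∨ i = 2 * k + 2 := ⟨(i - 1) / 2, by omega⟩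
  have hk1 : k + 1 < n := by omega
  have h1 : a (2 * k + 1) ≤ a (2 * k + 2) := hmono _ (by omega)
  have h2 : a (2 * k + 2) ≤ a (2 * k + 3) := hmono _ (by omega)
  have h3 : a (2 * k + 3) ≤ a (2 * k + 4) := hmono _ (by omega)
  have h4 : a (2 * k + 1) < a (2 * k + 3) := hstrict _ (by omega)
  have h5 : a (2 * k + 2) < a (2 * k + 4) := hstrict _ (by omega)
  suffices H : p (2 * k + 1) < p (2 * k + 3) ∧ p (2 * k + 2) < p (2 * k + 4) by
    rcases hk with rfl | rfl
    · exact H.1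
    · exact H.2
  have s0 := hswap k (by omega)
  have s1 := hswap (k + 1) hk1
  have f0 := hfix k (by omega)
  have f1 := hfix (k + 1) hk1
  simp only [show 2 * (k + 1) + 1 = 2 * k + 3 by ring,
    show 2 * (k + 1) + 2 = 2 * k + 4 by ring] at s1 f1
  by_cases h : a (2 * k + 2) = a (2 * k + 3)
  · have hiff : (∃ s ∈ X, I s ≤ 2 * k + 1 ∧ 2 * k + 2 ≤ I (s + 1)) ↔
        ∃ s ∈ X, I s ≤ 2 * k + 3 ∧ 2 * k + 4 ≤ I (s + 1) := by
      rcases (hG (i := 2 * k + 3) (by omega) (by omega)).2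
        (by rw [show 2 * k + 3 - 1 = 2 * k + 2 by omega]; simp only [h, true_iff]; omega)
        with h' | ⟨r, hr, hr2, h', h''⟩
      · constructor
        · rintro ⟨s, hs, hs', -⟩
          have := hpos s hs
          omega
        · rintro ⟨s, hs, hs', -⟩
          have := hpos s hs
          omega
      · refine exists_congr fun s => and_congr_right fun hs => ?_
        have hr3 := enum_mod_two hmono hstrict hImono hIJ hr.le
        have hr4 := enum_mod_two hmono hstrict hImono hIJ (s := r + 1) hr
        have hs3 := hX s hs
        rcases lt_trichotomy s r with hsr | rfl | hsr
        · have := hIle (s + 1) r hsr hr.le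
          omega
        · omega
        · have := hIle (r + 1) s hsr hs3.2.le
          omega
    by_cases hσ : ∃ s ∈ X, I s ≤ 2 * k + 1 ∧ 2 * k + 2 ≤ I (s + 1)
    · have s0 := s0 hσ
      have s1 := s1 (hiff.1 hσ)
      omega
    · have f0 := f0 hσ
      have f1 := f1 (mt hiff.2 hσ)
      omega
  · have h0 : (p (2 * k + 1) = a (2 * k + 1) ∧ p (2 * k + 2) = a (2 * k + 2)) ∨
        (p (2 * k + 1) = a (2 * k + 2) ∧ p (2 * k + 2) = a (2 * k + 1)) := by tauto
    have h1 : (p (2 * k + 3) = a (2 * k + 3) ∧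
          p (2 * k + 4) = a (2 * k + 4)) ∨
        (p (2 * k + 3) = a (2 * k + 4) ∧
          p (2 * k + 4) = a (2 * k + 3)) := by tauto
    omega

theorem IsPairSwap.exists_blocks (hmono : ∀ i, i + 1 ≤ 2 * n → a i ≤ a (i + 1))
    (hstrict : ∀ i, i + 2 ≤ 2 * n → a i < a (i + 2))
    (hImono : ∀ s t, s < t → t ≤ 2 * M → I s < I t)
    (hIJ : ∀ i, (i ≤ 2 * n ∧ ((Finset.range (2 * n + 1)).filter fun j => a j = a i).card = 1)
      ↔ ∃ s, s ≤ 2 * M ∧ I s = i)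
    (hm : ∀ s, s < 2 * M → I (s + 1) = I s + 2 * m s + 1)
    (h : IsPairSwap n a p) (hp : ∀ i, i + 2 ≤ 2 * n → p i < p (i + 2)) :
    ∃ X : Finset ℕ, (∀ s ∈ X, s % 2 = 1 ∧ s < 2 * M) ∧
      (∀ s ∈ X, ∀ k ≤ m s, p (I s + 2 * k) = a (I s + 2 * k + 1)
        ∧ p (I s + 2 * k + 1) = a (I s + 2 * k)) ∧
      ∀ i ≤ 2 * n, (∀ s ∈ X, ¬ (I s ≤ i ∧ i ≤ I s + 2 * m s + 1)) → p i = a i := by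
  have hG := fun {i : ℕ} => le_or_exists_mem_Ioc_iff hmono hstrict hImono hIJ (i := i)
  have hpar := fun {s : ℕ} => enum_mod_two hmono hstrict hImono hIJ (s := s)
  have hIN : ∀ s ≤ 2 * M, I s ≤ 2 * n := fun s hs => ((hIJ (I s)).2 ⟨s, hs, rfl⟩).1
  obtain ⟨hzero, hpair⟩ := h
  have hpair' : ∀ j, j % 2 = 1 → j + 1 ≤ 2 * n → (p j = a j ∧ p (j + 1) = a (j + 1)) ∨
      (p j = a (j + 1) ∧ p (j + 1) = a j) := by
    intro j hj hjn
    have := hpair (j / 2) (by omega)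
    rwa [show 2 * (j / 2) + 2 = j + 1 by omega, show 2 * (j / 2) + 1 = j by omega] at this
  -- below the first unpaired index nothing moves
  have hfix : ∀ k, 2 * k + 2 ≤ I 0 → p (2 * k + 1) = a (2 * k + 1) ∧
      p (2 * k + 2) = a (2 * k + 2) := by
    intro k
    have hI0 := hIN 0 (by omega)
    induction k with
    | zero =>
      intro hk
      have h1 := (hG (i := 1) (by omega) (by omega)).1 (.inl (by omega))
      have h2 := hp 0 (by omega)
      have h3 := hpair 0 (by omega)
      simp only [Nat.mul_zero, Nat.zero_add, Nat.sub_self, Nat.reduceMod, iff_true] at *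
      omega
    | succ k ih =>
      intro hk
      have ih := ih (by omega)
      have h1 := (hG (i := 2 * k + 3) (by omega) (by omega)).1 (.inl (by omega))
      rw [show 2 * k + 3 - 1 = 2 * k + 2 by omega] at h1
      have h1 := h1.2 (by omega)
      have h2 := hp (2 * k + 2) (by omega)
      have h3 := hpair (k + 1) (by omega)
      simp only [show 2 * (k + 1) + 1 = 2 * k + 3 by ring,
        show 2 * (k + 1) + 2 = 2 * k + 2 + 2 by ring] at h3 ⊢
      omega
  -- within a block all pairs behave alike
  have hblock : ∀ s < 2 * M, s % 2 = 1 → ∀ k ≤ m s,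
      (p (I s + 2 * k) = a (I s + 2 * k) ↔ p (I s) = a (I s)) := by
    intro s hs hs2 k hk
    have hN := hIN (s + 1) hs
    have hs3 := hpar hs.le
    have hms := hm s hs
    induction k with
    | zero => simp
    | succ k ih =>
      refine Iff.trans ?_ (ih (by omega))
      have h1 := (hG (i := I s + 2 * k + 1 + 1) (by omega) (by omega)).1
        (.inr ⟨s, hs, hs2, by omega, by omega⟩)
      rw [Nat.add_sub_cancel] at h1
      have h1 := h1.2 (by omega)
      have h2 := hp (I s + 2 * k) (by omega)
      have h3 := hp (I s + 2 * k + 1) (by omega)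
      have h4 := hstrict (I s + 2 * k) (by omega)
      have h5 := hstrict (I s + 2 * k + 1) (by omega)
      have h6 := hpair' (I s + 2 * k) (by omega) (by omega)
      have h7 := hpair' (I s + 2 * k + 2) (by omega) (by omega)
      rw [show I s + 2 * (k + 1) = I s + 2 * k + 2 by ring]
      simp only [show I s + 2 * k + 1 + 1 = I s + 2 * k + 2 by ring,
        show I s + 2 * k + 1 + 2 = I s + 2 * k + 2 + 1 by ring] at *
      omega
  refine ⟨(Finset.range (2 * M)).filter fun s => s % 2 = 1 ∧ p (I s) ≠ a (I s), fun s hs => ?_,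
    fun s hs k hk => ?_, fun i hi hiX => ?_⟩
  · simp only [Finset.mem_filter, Finset.mem_range] at hs
    exact ⟨hs.2.1, hs.1⟩
  · simp only [Finset.mem_filter, Finset.mem_range] at hs
    have hN := hIN (s + 1) hs.1
    have hs3 := hpar hs.1.le
    have hms := hm s hs.1
    rcases hpair' (I s + 2 * k) (by omega) (by omega) with h | h
    · exact absurd ((hblock s hs.1 hs.2.1 k hk).1 h.1) hs.2.2
    · exact h
  · rcases Nat.eq_zero_or_pos i with rfl | hi0
    · exact hzero
    obtain ⟨k, hk⟩ : ∃ k, i = 2 * k + 1 ∨ i = 2 * k + 2 := ⟨(i - 1) / 2, by omega⟩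
    suffices H : p (2 * k + 1) = a (2 * k + 1) ∧ p (2 * k + 2) = a (2 * k + 2) by
      rcases hk with rfl | rfl
      · exact H.1
      · exact H.2
    have h1 := hpair k (by omega)
    by_cases heq : a (2 * k + 1) = a (2 * k + 2)
    · omega
    rcases (hG (i := 2 * k + 2) (by omega) (by omega)).2
      (by rw [show 2 * k + 2 - 1 = 2 * k + 1 by omega]; simp only [heq, false_iff]; omega)
      with h' | ⟨s, hs, hs2, hs3, hs4⟩
    · exact hfix k h'
    · have hms := hm s hs
      have hsp := hpar hs.le
      have hsX : p (I s) = a (I s) := by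
        by_contra hne
        refine hiX s ?_ (by omega)
        simp only [Finset.mem_filter, Finset.mem_range]
        exact ⟨hs, hs2, hne⟩
      have := (hblock s hs hs2 (k - I s / 2) (by omega)).2 hsX
      rw [show I s + 2 * (k - I s / 2) = 2 * k + 1 by omega] at this
      omega

end Blocks

/-! ### Pairs of sets as interleaved sequences -/

section Interleaved

variable {n : ℕ} {a p : ℕ → ℕ}

theorem sort_even (hp : ∀ i, i + 2 ≤ 2 * n → p i < p (i + 2)) :
    ((Finset.range (n + 1)).image fun k => p (2 * k) + k).sort (· ≤ ·) =
      (List.range (n + 1)).map fun k => p (2 * k) + k :=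
  sort_image_range fun i j hij hj =>
    Nat.add_lt_add (lt_of_forall_lt_add_two (c := 0) hp hij (by omega)) hij

theorem sort_odd (hp : ∀ i, i + 2 ≤ 2 * n → p i < p (i + 2)) :
    ((Finset.range n).image fun k => p (2 * k + 1) + (k + 1)).sort (· ≤ ·) =
      (List.range n).map fun k => p (2 * k + 1) + (k + 1) :=
  sort_image_range fun i j hij hj =>
    Nat.add_lt_add (lt_of_forall_lt_add_two (c := 1) hp hij (by omega)) (by omega)

theorem mapIdx_sort_even (hp : ∀ i, i + 2 ≤ 2 * n → p i < p (i + 2)) :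
    (((Finset.range (n + 1)).image fun k => p (2 * k) + k).sort (· ≤ ·)).mapIdx
        (fun k x => x - k) = (List.range (n + 1)).map fun k => p (2 * k) := by
  simp only [sort_even hp, mapIdx_map_range, Nat.add_sub_cancel]

theorem mapIdx_sort_odd (hp : ∀ i, i + 2 ≤ 2 * n → p i < p (i + 2)) :
    (((Finset.range n).image fun k => p (2 * k + 1) + (k + 1)).sort (· ≤ ·)).mapIdx
        (fun k y => y - (k + 1)) = (List.range n).map fun k => p (2 * k + 1) := by
  simp only [sort_odd hp, mapIdx_map_range, Nat.add_sub_cancel]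

theorem toFinset_mapIdx_sort_even (hp : ∀ i, i + 2 ≤ 2 * n → p i < p (i + 2)) :
    ((((Finset.range (n + 1)).image fun k => p (2 * k) + k).sort (· ≤ ·)).mapIdx
        fun k x => x - k).toFinset = (Finset.range (n + 1)).image fun k => p (2 * k) := by
  rw [mapIdx_sort_even hp]
  ext; simp

theorem toFinset_mapIdx_sort_odd (hp : ∀ i, i + 2 ≤ 2 * n → p i < p (i + 2)) :
    ((((Finset.range n).image fun k => p (2 * k + 1) + (k + 1)).sort (· ≤ ·)).mapIdx
        fun k y => y - (k + 1)).toFinset = (Finset.range n).image fun k => p (2 * k + 1) := by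
  rw [mapIdx_sort_odd hp]
  ext; simp

theorem mapIdx_sort_add_mapIdx_sort (hp : ∀ i, i + 2 ≤ 2 * n → p i < p (i + 2)) :
    (((((Finset.range (n + 1)).image fun k => p (2 * k) + k).sort (· ≤ ·)).mapIdx
        fun k x => x - k : List ℕ) : Multiset ℕ) +
      (((((Finset.range n).image fun k => p (2 * k + 1) + (k + 1)).sort (· ≤ ·)).mapIdx
        fun k y => y - (k + 1) : List ℕ) : Multiset ℕ) =
      (Multiset.range (2 * n + 1)).map p := by
  rw [mapIdx_sort_even hp, mapIdx_sort_odd hp, map_range_two_mul_add_one]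
  rfl

theorem val_add_val_eq (hp : ∀ i, i + 2 ≤ 2 * n → p i < p (i + 2)) :
    ((Finset.range (n + 1)).image fun k => p (2 * k) + k).val +
        ((Finset.range n).image fun k => p (2 * k + 1) + (k + 1)).val =
      (Multiset.range (2 * n + 1)).map fun i => p i + (i + 1) / 2 := by
  rw [← Finset.sort_eq _ (· ≤ ·), ← Finset.sort_eq (Finset.image _ (Finset.range n)) (· ≤ ·),
    sort_even hp, sort_odd hp, map_range_two_mul_add_one]
  simp only [show ∀ k, (2 * k + 1) / 2 = k by omega, show ∀ k, (2 * k + 1 + 1) / 2 = k + 1 by omega]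
  rfl

theorem exists_isPairSwap_of_card_eq (hmono : ∀ i, i + 1 ≤ 2 * n → a i ≤ a (i + 1))
    {A B : Finset ℕ} (h0 : 0 ∉ B) (hA : ∀ x ∈ A, x + 1 ∉ A) (hB : ∀ x ∈ B, x + 1 ∉ B)
    (hAc : A.card = n + 1) (hBc : B.card = n)
    (hshift : A.val + B.val = (Multiset.range (2 * n + 1)).map fun i => a i + (i + 1) / 2)
    (hval : (((A.sort (· ≤ ·)).mapIdx fun k x => x - k : List ℕ) : Multiset ℕ)
      + (((B.sort (· ≤ ·)).mapIdx fun k y => y - (k + 1) : List ℕ) : Multiset ℕ)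
      = (Multiset.range (2 * n + 1)).map a) :
    ∃ p : ℕ → ℕ, (∀ i, i + 2 ≤ 2 * n → p i < p (i + 2)) ∧
      IsPairSwap n a p ∧ A = (Finset.range (n + 1)).image (fun k => p (2 * k) + k) ∧
      B = (Finset.range n).image fun k => p (2 * k + 1) + (k + 1) := by
  obtain ⟨x, hx, hAx⟩ := exists_strictMono_image_range A
  obtain ⟨y, hy, hBy⟩ := exists_strictMono_image_range B
  rw [hAc] at hx hAx
  rw [hBc] at hy hBy
  have hxmem : ∀ k < n + 1, x k ∈ A := fun k hk => by
    rw [hAx]; exact Finset.mem_image_of_mem x (Finset.mem_range.2 hk)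
  have hymem : ∀ k < n, y k ∈ B := fun k hk => by
    rw [hBy]; exact Finset.mem_image_of_mem y (Finset.mem_range.2 hk)
  have hx2 : ∀ k, k + 1 < n + 1 → x k + 2 ≤ x (k + 1) := fun k hk => by
    have h1 := hx k (k + 1) (by omega) hk
    have h2 : x k + 1 ≠ x (k + 1) := fun h =>
      hA _ (hxmem k (by omega)) (h ▸ hxmem (k + 1) hk)
    omega
  have hy2 : ∀ k, k + 1 < n → y k + 2 ≤ y (k + 1) := fun k hk => by
    have h1 := hy k (k + 1) (by omega) hk
    have h2 : y k + 1 ≠ y (k + 1) := fun h =>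
      hB _ (hymem k (by omega)) (h ▸ hymem (k + 1) hk)
    omega
  have hxk : ∀ k < n + 1, k ≤ x k := fun k => by
    induction k with
    | zero => simp
    | succ k ih => intro hk; have := ih (by omega); have := hx2 k hk; omega
  have hyk : ∀ k < n, k + 1 ≤ y k := fun k => by
    induction k with
    | zero => exact fun hk => Nat.pos_of_ne_zero fun h => h0 (h ▸ hymem 0 hk)
    | succ k ih => intro hk; have := ih (by omega); have := hy2 k hk; omega
  let p : ℕ → ℕ := fun i => if i % 2 = 0 then x (i / 2) - i / 2 else y (i / 2) - (i / 2 + 1)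
  have hpx : ∀ k, p (2 * k) = x k - k := fun k => by simp [p]
  have hpy : ∀ k, p (2 * k + 1) = y k - (k + 1) := fun k => by
    simp [p, show (2 * k + 1) / 2 = k by omega]
  have hp : ∀ i, i + 2 ≤ 2 * n → p i < p (i + 2) := by
    intro i hi
    rcases Nat.even_or_odd' i with ⟨k, rfl | rfl⟩
    · rw [show 2 * k + 2 = 2 * (k + 1) by ring, hpx, hpx]
      have := hx2 k (by omega)
      have := hxk k (by omega)
      omega
    · rw [show 2 * k + 1 + 2 = 2 * (k + 1) + 1 by ring, hpy, hpy]
      have := hy2 k (by omega)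
      have := hyk k (by omega)
      omega
  have hAp : A = (Finset.range (n + 1)).image (fun k => p (2 * k) + k) := by
    rw [hAx]
    refine Finset.image_congr fun k hk => ?_
    have := hxk k (Finset.mem_range.1 hk)
    simp only [hpx]
    omega
  have hBp : B = (Finset.range n).image fun k => p (2 * k + 1) + (k + 1) := by
    rw [hBy]
    refine Finset.image_congr fun k hk => ?_
    have := hyk k (Finset.mem_range.1 hk)
    simp only [hpy]
    omega
  refine ⟨p, hp, isPairSwap_of_map_range_eq hmono ?_ ?_, hAp, hBp⟩
  · rw [← hval, hAp, hBp, mapIdx_sort_add_mapIdx_sort hp]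
  · rw [← hshift, hAp, hBp, val_add_val_eq hp]

end Interleaved

/-- Setup §1: the map `(A,B) ↦ (A⁻, B⁻)` is a bijection from the
set `T₁` (see Statement 9) onto the set
`𝔗₁ = { ({a^X_i : i ≤ N even}, {a^X_i : i ≤ N odd}) : X ⊆ {1,3,…,2M-1} }`. -/
theorem stmt_10 (N M : ℕ) (a I m : ℕ → ℕ)
    (hN : Even N)
    (hmono : ∀ i, i + 1 ≤ N → a i ≤ a (i + 1))
    (hstrict : ∀ i, i + 2 ≤ N → a i < a (i + 2))
    (hImono : ∀ s t, s < t → t ≤ 2 * M → I s < I t)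
    (hIJ : ∀ i, (i ≤ N ∧ ((Finset.range (N + 1)).filter fun j => a j = a i).card = 1)
        ↔ ∃ s, s ≤ 2 * M ∧ I s = i)
    (hm : ∀ s, s < 2 * M → I (s + 1) = I s + 2 * m s + 1)
    (T₁ : Set (Finset ℕ × Finset ℕ))
    (hT₁ : T₁ = {p : Finset ℕ × Finset ℕ |
      0 ∉ p.2
      ∧ (∀ x ∈ p.1, x + 1 ∉ p.1)
      ∧ (∀ x ∈ p.2, x + 1 ∉ p.2)
      ∧ p.1.card = N / 2 + 1
      ∧ p.2.card = N / 2
      ∧ p.1.val + p.2.val = (Multiset.range (N + 1)).map (fun i => a i + (i + 1) / 2)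
      ∧ ((((p.1.sort (· ≤ ·)).mapIdx fun k x => x - k : List ℕ) : Multiset ℕ)
          + (((p.2.sort (· ≤ ·)).mapIdx fun k y => y - (k + 1) : List ℕ) : Multiset ℕ))
          = (Multiset.range (N + 1)).map a})
    (𝔗₁ : Set (Finset ℕ × Finset ℕ))
    (h𝔗₁ : 𝔗₁ = {q : Finset ℕ × Finset ℕ | ∃ X : Finset ℕ,
      (∀ s ∈ X, s % 2 = 1 ∧ s < 2 * M)
      ∧ ∃ p : ℕ → ℕ,
        -- `p` is the sequence `a^X`:
        (∀ s ∈ X, ∀ k ≤ m s, p (I s + 2 * k) = a (I s + 2 * k + 1)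
            ∧ p (I s + 2 * k + 1) = a (I s + 2 * k))
        ∧ (∀ i ≤ N, (∀ s ∈ X, ¬ (I s ≤ i ∧ i ≤ I s + 2 * m s + 1)) → p i = a i)
        ∧ q.1 = ((Finset.range (N + 1)).filter fun i => i % 2 = 0).image p
        ∧ q.2 = ((Finset.range (N + 1)).filter fun i => i % 2 = 1).image p}) :
    Set.BijOn (fun p : Finset ℕ × Finset ℕ =>
        (((p.1.sort (· ≤ ·)).mapIdx fun k x => x - k).toFinset,
         ((p.2.sort (· ≤ ·)).mapIdx fun k y => y - (k + 1)).toFinset))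
      T₁ 𝔗₁ := by
  obtain ⟨n, hn⟩ := hN
  obtain rfl : N = 2 * n := by omega
  have hhalf : 2 * n / 2 = n := by omega
  rw [hhalf] at hT₁
  have hexists : ∀ A B, (A, B) ∈ T₁ → ∃ p : ℕ → ℕ, (∀ i, i + 2 ≤ 2 * n → p i < p (i + 2)) ∧
      IsPairSwap n a p ∧ A = (Finset.range (n + 1)).image (fun k => p (2 * k) + k) ∧
      B = (Finset.range n).image fun k => p (2 * k + 1) + (k + 1) := by
    intro A B hAB
    rw [hT₁] at hAB
    obtain ⟨h0, hA, hB, hAc, hBc, hshift, hval⟩ := hAB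
    exact exists_isPairSwap_of_card_eq hmono h0 hA hB hAc hBc hshift hval
  refine ⟨?_, ?_, ?_⟩
  · rintro ⟨A, B⟩ hAB
    obtain ⟨p, hp, hps, rfl, rfl⟩ := hexists A B hAB
    obtain ⟨X, hX, hpX, hpX'⟩ := hps.exists_blocks hmono hstrict hImono hIJ hm hp
    rw [h𝔗₁]
    refine ⟨X, hX, p, hpX, hpX', ?_⟩
    rw [(image_filter_mod_two p).1, (image_filter_mod_two p).2]
    simp only [toFinset_mapIdx_sort_even hp, toFinset_mapIdx_sort_odd hp, and_self]
  · rintro ⟨A, B⟩ hAB ⟨A', B'⟩ hAB' heq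
    obtain ⟨p, hp, -, rfl, rfl⟩ := hexists A B hAB
    obtain ⟨q, hq, -, rfl, rfl⟩ := hexists A' B' hAB'
    simp only [toFinset_mapIdx_sort_even hp, toFinset_mapIdx_sort_odd hp,
      toFinset_mapIdx_sort_even hq, toFinset_mapIdx_sort_odd hq, Prod.mk.injEq] at heq
    have hlt := fun {r : ℕ → ℕ} (hr : ∀ i, i + 2 ≤ 2 * n → r i < r (i + 2)) (i j : ℕ)
      (hij : i < j) (hj : j < n + 1) => lt_of_forall_lt_add_two (c := 0) hr hij (by omega)
    have hlt' := fun {r : ℕ → ℕ} (hr : ∀ i, i + 2 ≤ 2 * n → r i < r (i + 2)) (i j : ℕ)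
      (hij : i < j) (hj : j < n) => lt_of_forall_lt_add_two (c := 1) hr hij (by omega)
    rw [Prod.mk.injEq]
    constructor
    · refine Finset.image_congr fun k hk => ?_
      have := eq_of_image_range_eq (hlt hp) (hlt hq) heq.1 (Finset.mem_range.1 hk)
      simp only [Nat.add_zero] at this
      simp only [this]
    · refine Finset.image_congr fun k hk => ?_
      have := eq_of_image_range_eq (hlt' hp) (hlt' hq) heq.2 (Finset.mem_range.1 hk)
      simp only [this]
  · rintro ⟨C, D⟩ hCD
    rw [h𝔗₁] at hCD
    obtain ⟨X, hX, p, hpX, hpX', hC, hD⟩ := hCD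
    obtain ⟨hps, hp⟩ := isPairSwap_of_blocks hmono hstrict hImono hIJ hm hX hpX hpX'
    rw [(image_filter_mod_two p).1] at hC
    rw [(image_filter_mod_two p).2] at hD
    refine ⟨((Finset.range (n + 1)).image (fun k => p (2 * k) + k),
      (Finset.range n).image fun k => p (2 * k + 1) + (k + 1)), ?_, ?_⟩
    · rw [hT₁]
      have hA := sort_even hp
      have hB := sort_odd hp
      refine ⟨by simp, ?_, ?_, ?_, ?_, ?_, ?_⟩
      · simp only [Finset.mem_image, Finset.mem_range]
        rintro x ⟨i, hi, rfl⟩ ⟨j, hj, hij⟩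
        rcases lt_trichotomy i j with h | rfl | h
        · have := lt_of_forall_lt_add_two (c := 0) hp h (by omega)
          simp only [Nat.add_zero] at this
          omega
        · omega
        · have := lt_of_forall_lt_add_two (c := 0) hp h (by omega)
          simp only [Nat.add_zero] at this
          omega
      · simp only [Finset.mem_image, Finset.mem_range]
        rintro x ⟨i, hi, rfl⟩ ⟨j, hj, hij⟩
        rcases lt_trichotomy i j with h | rfl | h
        · have := lt_of_forall_lt_add_two (c := 1) hp h (by omega)
          omega
        · omega
        · have := lt_of_forall_lt_add_two (c := 1) hp h (by omega)
          omega
      · rw [← Finset.length_sort (· ≤ ·), hA]; simp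
      · rw [← Finset.length_sort (· ≤ ·), hB]; simp
      · rw [← hps.map_range_eq (fun i x => x + (i + 1) / 2) fun k => by funext x; omega]
        exact val_add_val_eq hp
      · rw [← hps.map_range_eq (fun _ x => x) fun _ => rfl]
        exact mapIdx_sort_add_mapIdx_sort hp
    · simp only [toFinset_mapIdx_sort_even hp, toFinset_mapIdx_sort_odd hp, ← hC, ← hD]
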